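/- (Infinitesimal Gauss rigidity of simple convex spherical polyhedra.) Let u₁,…,uₙ ∈ S³ = {x ∈ ℝ⁴ : ‖x‖ = 1} be pairwise distinct and let C = {x ∈ ℝ⁴ : ⟨x, uᵢ⟩ ≤ 0 for all i}. Assume: C has nonempty interior; C is pointed (C ∩ (−C) = {0}); for every i the facet cone C ∩ {x : ⟨x, uᵢ⟩ = 0} has linear span of dimension 3; and C is simple, i.e., every extreme ray of C is contained in exactly three of the hyperplanes {x : ⟨x, uᵢ⟩ = 0}. Call a pair (i, j), i ≠ j, adjacent if the span of C ∩ {x : ⟨x, uᵢ⟩ = 0} ∩ {x : ⟨x, uⱼ⟩ = 0} has dimension 2. If w : {1,…,n} → ℝ⁴ satisfies ⟨uᵢ, wᵢ⟩ = 0 for every i and ⟨wᵢ, uⱼ⟩ + ⟨uᵢ, wⱼ⟩ = 0 for every adjacent pair (i, j) (the dihedral angles of the polyhedron are constant in the first order), then there exists a skew-symmetric linear map A : ℝ⁴ → ℝ⁴ (Aᵀ = −A) with wᵢ = A(uᵢ) for every i (the deformation is the restriction of an infinitesimal rotation, i.e., the polyhedron is congruent to itself in the first order). -/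

import Mathlib

open scoped RealInnerProductSpace

/-- Euclidean four-space. -/
abbrev E4 : Type := EuclideanSpace ℝ (Fin 4)

/-- The triple cross product of `ℝ⁴`. -/
noncomputable def cross3 (a b c : E4) : E4 :=
  !₂[-(a 1 * (b 2 * c 3 - b 3 * c 2) - a 2 * (b 1 * c 3 - b 3 * c 1)
        + a 3 * (b 1 * c 2 - b 2 * c 1)),
    a 0 * (b 2 * c 3 - b 3 * c 2) - a 2 * (b 0 * c 3 - b 3 * c 0)
        + a 3 * (b 0 * c 2 - b 2 * c 0),
    -(a 0 * (b 1 * c 3 - b 3 * c 1) - a 1 * (b 0 * c 3 - b 3 * c 0)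
        + a 3 * (b 0 * c 1 - b 1 * c 0)),
    a 0 * (b 1 * c 2 - b 2 * c 1) - a 1 * (b 0 * c 2 - b 2 * c 0)
        + a 2 * (b 0 * c 1 - b 1 * c 0)]

/-- The determinant of four vectors of `ℝ⁴`. -/
noncomputable def det4 (a b c d : E4) : ℝ := ⟪cross3 a b c, d⟫

lemma inner_eq_sum_four (x y : E4) :
    ⟪x, y⟫ = x 0 * y 0 + x 1 * y 1 + x 2 * y 2 + x 3 * y 3 := by
  simp [PiLp.inner_apply, Fin.sum_univ_four]
  ring

lemma inner_cross3 (a b c d : E4) : ⟪cross3 a b c, d⟫ = det4 a b c d := rfl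

lemma det4_eq (a b c d : E4) : det4 a b c d =
    -(a 1 * (b 2 * c 3 - b 3 * c 2) - a 2 * (b 1 * c 3 - b 3 * c 1)
        + a 3 * (b 1 * c 2 - b 2 * c 1)) * d 0
    + (a 0 * (b 2 * c 3 - b 3 * c 2) - a 2 * (b 0 * c 3 - b 3 * c 0)
        + a 3 * (b 0 * c 2 - b 2 * c 0)) * d 1
    + -(a 0 * (b 1 * c 3 - b 3 * c 1) - a 1 * (b 0 * c 3 - b 3 * c 0)
        + a 3 * (b 0 * c 1 - b 1 * c 0)) * d 2
    + (a 0 * (b 1 * c 2 - b 2 * c 1) - a 1 * (b 0 * c 2 - b 2 * c 0)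
        + a 2 * (b 0 * c 1 - b 1 * c 0)) * d 3 := by
  rw [det4, inner_eq_sum_four]
  simp [cross3]

lemma det4_swap₁ (a b c d : E4) : det4 b a c d = -det4 a b c d := by
  simp only [det4_eq]; ring

lemma det4_swap₂ (a b c d : E4) : det4 a c b d = -det4 a b c d := by
  simp only [det4_eq]; ring

lemma det4_swap₃ (a b c d : E4) : det4 a b d c = -det4 a b c d := by
  simp only [det4_eq]; ring

lemma det4_self₁ (a c d : E4) : det4 a a c d = 0 := by
  simp only [det4_eq]; ring

lemma det4_self₃ (a b c : E4) : det4 a b c c = 0 := by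
  simp only [det4_eq]; ring

lemma det4_self₁₄ (a b c : E4) : det4 a b c a = 0 := by
  simp only [det4_eq]; ring

lemma det4_self₂₄ (a b c : E4) : det4 a b c b = 0 := by
  simp only [det4_eq]; ring

lemma det4_add₂ (a b b' c d : E4) : det4 a (b + b') c d = det4 a b c d + det4 a b' c d := by
  simp only [det4_eq, PiLp.add_apply]; ring

lemma det4_smul₂ (r : ℝ) (a b c d : E4) : det4 a (r • b) c d = r * det4 a b c d := by
  simp only [det4_eq, PiLp.smul_apply, smul_eq_mul]; ring

lemma det4_sum₂ {ι : Type*} (J : Finset ι) (f : ι → ℝ) (v : ι → E4) (a c d : E4) :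
    det4 a (∑ j ∈ J, f j • v j) c d = ∑ j ∈ J, f j * det4 a (v j) c d := by
  classical
  induction J using Finset.induction_on with
  | empty => simp [det4_eq]
  | insert j J hj ih => rw [Finset.sum_insert hj, Finset.sum_insert hj, det4_add₂, det4_smul₂, ih]

lemma cross3_swap₁ (a b c : E4) : cross3 b a c = -cross3 a b c := by
  ext i; fin_cases i <;> simp [cross3] <;> ring

lemma cross3_rotate (a b c : E4) : cross3 b c a = cross3 a b c := by
  ext i; fin_cases i <;> simp [cross3] <;> ring

/-- The linear relation between five vectors of `ℝ⁴`. -/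
lemma five_term (u v v' p q : E4) :
    det4 u v' p q • v - det4 u v p q • v' =
      det4 u v v' p • q + det4 v v' p q • u - det4 u v v' q • p := by
  ext i
  simp only [det4_eq, PiLp.sub_apply, PiLp.add_apply, PiLp.smul_apply, smul_eq_mul]
  fin_cases i <;> simp <;> ring

/-- Cramer's rule in `ℝ⁴`. -/
lemma cramer4 (a b c d x : E4) :
    det4 a b c d • x =
      det4 x b c d • a + det4 a x c d • b + det4 a b x d • c + det4 a b c x • d := by
  ext i
  simp only [det4_eq, PiLp.add_apply, PiLp.smul_apply, smul_eq_mul]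
  fin_cases i <;> simp <;> ring

lemma eq_zero_of_inner_eq_zero {a b c d x : E4} (h : det4 a b c d ≠ 0) (ha : ⟪x, a⟫ = 0)
    (hb : ⟪x, b⟫ = 0) (hc : ⟪x, c⟫ = 0) (hd : ⟪x, d⟫ = 0) : x = 0 := by
  have := congrArg (fun y => ⟪x, y⟫) (cramer4 a b c d x)
  simp only [inner_add_right, real_inner_smul_right, ha, hb, hc, hd, mul_zero, add_zero] at this
  rcases mul_eq_zero.1 this with h' | h'
  · exact absurd h' h
  · exact inner_self_eq_zero.1 h'

lemma eq_zero_of_det4_eq_zero {a : E4} (h : ∀ x y z, det4 a x y z = 0) : a = 0 := by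
  let e : Fin 4 → E4 := fun i => EuclideanSpace.single i 1
  have h0 := h (e 1) (e 2) (e 3)
  have h1 := h (e 0) (e 2) (e 3)
  have h2 := h (e 0) (e 1) (e 3)
  have h3 := h (e 0) (e 1) (e 2)
  simp [det4_eq, e] at h0 h1 h2 h3
  ext i
  fin_cases i <;> simpa

lemma det4_cross3_pos {a b c : E4} (h : cross3 a b c ≠ 0) :
    0 < det4 a b c (cross3 a b c) := by
  rw [det4]; exact real_inner_self_pos.2 h

lemma cross3_ne_zero_of_det4 {a b c d : E4} (h : det4 a b c d ≠ 0) : cross3 a b c ≠ 0 := by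
  rintro h0
  exact h (by rw [det4, h0, inner_zero_left])

/-- A vector orthogonal to three vectors is a multiple of their cross product. -/
lemma eq_smul_cross3 {a b c x : E4} (h : cross3 a b c ≠ 0) (ha : ⟪x, a⟫ = 0)
    (hb : ⟪x, b⟫ = 0) (hc : ⟪x, c⟫ = 0) : ∃ t : ℝ, x = t • cross3 a b c := by
  have hN := det4_cross3_pos h
  refine ⟨⟪x, cross3 a b c⟫ / det4 a b c (cross3 a b c), ?_⟩
  rw [← sub_eq_zero]
  apply eq_zero_of_inner_eq_zero hN.ne' <;>
    simp only [inner_sub_left, real_inner_smul_left, inner_cross3, det4_self₁₄, det4_self₂₄,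
      det4_self₃, ha, hb, hc, mul_zero, sub_zero]
  field_simp
  simp

/-- Dual vector to the first of four independent vectors. -/
lemma exists_dual {a b c d : E4} (h : det4 a b c d ≠ 0) :
    ∃ y : E4, ⟪y, a⟫ = 1 ∧ ⟪y, b⟫ = 0 ∧ ⟪y, c⟫ = 0 ∧ ⟪y, d⟫ = 0 := by
  have h' : det4 b c d a = -det4 a b c d := by simp only [det4_eq]; ring
  refine ⟨(-(det4 a b c d)⁻¹) • cross3 b c d, ?_, ?_, ?_, ?_⟩ <;>
    simp only [real_inner_smul_left, inner_cross3, det4_self₁₄, det4_self₂₄, det4_self₃, mul_zero]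
  rw [h']; field_simp

/-- A skew-symmetric linear map. -/
def IsSkew (A : E4 →ₗ[ℝ] E4) : Prop := ∀ x y, ⟪A x, y⟫ = -⟪x, A y⟫

lemma IsSkew.inner_self {A : E4 →ₗ[ℝ] E4} (hA : IsSkew A) (x : E4) : ⟪A x, x⟫ = 0 := by
  have := hA x x
  rw [real_inner_comm (A x) x] at this
  linarith

lemma IsSkew.sub {A B : E4 →ₗ[ℝ] E4} (hA : IsSkew A) (hB : IsSkew B) : IsSkew (A - B) := by
  intro x y
  simp only [LinearMap.sub_apply, inner_sub_left, inner_sub_right, hA x y, hB x y]; ring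

lemma isSkew_of_inner_self {A : E4 →ₗ[ℝ] E4} (h : ∀ x, ⟪A x, x⟫ = 0) : IsSkew A := by
  intro x y
  have := h (x + y)
  simp only [map_add, inner_add_left, inner_add_right, h x, h y] at this
  rw [real_inner_comm (A y) x]; linarith

/-- A skew map that kills two vectors is a multiple of the form `det4 a b · ·`. -/
lemma IsSkew.exists_eq_det4 {S : E4 →ₗ[ℝ] E4} (hS : IsSkew S) {a b c d : E4}
    (h : det4 a b c d ≠ 0) (ha : S a = 0) (hb : S b = 0) :
    ∃ s : ℝ, ∀ x y, ⟪S x, y⟫ = s * det4 a b x y := by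
  refine ⟨⟪S c, d⟫ / det4 a b c d, fun x y => ?_⟩
  have hx := congrArg S (cramer4 a b c d x)
  have hy := cramer4 a b c d y
  simp only [map_add, map_smul, ha, hb, smul_zero, zero_add] at hx
  have h1 : ∀ z, ⟪S z, a⟫ = 0 := fun z => by rw [hS, ha]; simp
  have h2 : ∀ z, ⟪S z, b⟫ = 0 := fun z => by rw [hS, hb]; simp
  have h3 : ⟪S d, c⟫ = -⟪S c, d⟫ := by rw [hS, real_inner_comm]
  have key : det4 a b c d * (det4 a b c d * ⟪S x, y⟫) =
      ⟪S c, d⟫ * (det4 a b x d * det4 a b c y - det4 a b c x * det4 a b y d) := by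
    rw [← real_inner_smul_left, ← real_inner_smul_right, hx, hy]
    simp only [inner_add_left, inner_add_right, real_inner_smul_left, real_inner_smul_right, h1,
      h2, hS.inner_self, h3]
    ring
  have pl : det4 a b x d * det4 a b c y - det4 a b c x * det4 a b y d =
      det4 a b c d * det4 a b x y := by
    simp only [det4_eq]; ring
  rw [pl] at key
  field_simp
  apply mul_left_cancel₀ h
  linear_combination key

lemma IsSkew.eq_of_eq_on {A B : E4 →ₗ[ℝ] E4} (hA : IsSkew A) (hB : IsSkew B) {a b c : E4}
    (h : cross3 a b c ≠ 0) (ha : A a = B a) (hb : A b = B b) (hc : A c = B c) : A = B := by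
  have hN := det4_cross3_pos h
  obtain ⟨s, hs⟩ := (hA.sub hB).exists_eq_det4 hN.ne' (by simp [ha]) (by simp [hb])
  have h0 := hs c (cross3 a b c)
  rw [LinearMap.sub_apply, hc, sub_self, inner_zero_left] at h0
  have hs0 : s = 0 := by
    rcases mul_eq_zero.1 h0.symm with h' | h'
    · exact h'
    · exact absurd h' hN.ne'
  ext1 x
  have := hs x ((A - B) x)
  rw [hs0, zero_mul, inner_self_eq_zero, LinearMap.sub_apply, sub_eq_zero] at this
  exact this

/-- An infinitesimal isometry of three independent vectors extends to a skew map. -/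
lemma exists_isSkew {a b c a' b' c' : E4} (h : cross3 a b c ≠ 0)
    (haa : ⟪a', a⟫ = 0) (hbb : ⟪b', b⟫ = 0) (hcc : ⟪c', c⟫ = 0)
    (hab : ⟪a', b⟫ + ⟪b', a⟫ = 0) (hbc : ⟪b', c⟫ + ⟪c', b⟫ = 0) (hca : ⟪c', a⟫ + ⟪a', c⟫ = 0) :
    ∃ A : E4 →ₗ[ℝ] E4, IsSkew A ∧ A a = a' ∧ A b = b' ∧ A c = c' := by
  have hN := det4_cross3_pos h
  set N := cross3 a b c with hNdef
  have hNa : ⟪N, a⟫ = 0 := det4_self₁₄ a b c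
  have hNb : ⟪N, b⟫ = 0 := det4_self₂₄ a b c
  have hNc : ⟪N, c⟫ = 0 := det4_self₃ a b c
  have hNN : ⟪N, N⟫ ≠ 0 := hN.ne'
  have e1 : det4 b a c N = -det4 a b c N := det4_swap₁ a b c N
  have e2 : det4 c a b N = det4 a b c N := by simp only [det4_eq]; ring
  obtain ⟨g₁, g1a, g1b, g1c, g1N⟩ := exists_dual hN.ne'
  obtain ⟨g₂, g2b, g2a, g2c, g2N⟩ := exists_dual (by rw [e1]; exact neg_ne_zero.2 hN.ne')
  obtain ⟨g₃, g3c, g3a, g3b, g3N⟩ := exists_dual (by rw [e2]; exact hN.ne')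
  let f : E4 → E4 →ₗ[ℝ] ℝ := fun g => (innerₗ E4 g)
  have hf : ∀ g x, f g x = ⟪g, x⟫ := fun g x => rfl
  let A : E4 →ₗ[ℝ] E4 := (f g₁).smulRight a' + (f g₂).smulRight b' + (f g₃).smulRight c'
    - (f ((⟪N, N⟫)⁻¹ • N)).smulRight (⟪a', N⟫ • g₁ + ⟪b', N⟫ • g₂ + ⟪c', N⟫ • g₃)
  have hA : ∀ x, A x = ⟪g₁, x⟫ • a' + ⟪g₂, x⟫ • b' + ⟪g₃, x⟫ • c'
      - ((⟪N, N⟫)⁻¹ * ⟪N, x⟫) • (⟪a', N⟫ • g₁ + ⟪b', N⟫ • g₂ + ⟪c', N⟫ • g₃) := by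
    intro x; simp [A, hf, real_inner_smul_left]
  refine ⟨A, isSkew_of_inner_self fun x => ?_, ?_, ?_, ?_⟩
  · have hx : x = ⟪g₁, x⟫ • a + ⟪g₂, x⟫ • b + ⟪g₃, x⟫ • c + ((⟪N, N⟫)⁻¹ * ⟪N, x⟫) • N := by
      have hc4 := cramer4 a b c N x
      have k : ∀ g : E4, det4 a b c N * ⟪g, x⟫ = det4 x b c N * ⟪g, a⟫ + det4 a x c N * ⟪g, b⟫
          + det4 a b x N * ⟪g, c⟫ + det4 a b c x * ⟪g, N⟫ := by
        intro g
        have := congrArg (fun y => ⟪g, y⟫) hc4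
        simpa only [inner_add_right, real_inner_smul_right] using this
      have k1 := k g₁
      have k2 := k g₂
      have k3 := k g₃
      rw [g1a, g1b, g1c, g1N] at k1
      rw [g2a, g2b, g2c, g2N] at k2
      rw [g3a, g3b, g3c, g3N] at k3
      have hD : det4 a b c N = ⟪N, N⟫ := rfl
      have hDx : det4 a b c x = ⟪N, x⟫ := rfl
      apply smul_right_injective E4 hN.ne'
      simp only [smul_add, smul_smul]
      rw [hc4, k1, k2, k3, hD, hDx, mul_inv_cancel_left₀ hNN]
      simp
    have q : ∀ y : E4, ⟪y, x⟫ = ⟪g₁, x⟫ * ⟪y, a⟫ + ⟪g₂, x⟫ * ⟪y, b⟫ + ⟪g₃, x⟫ * ⟪y, c⟫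
        + ((⟪N, N⟫)⁻¹ * ⟪N, x⟫) * ⟪y, N⟫ := by
      intro y
      conv_lhs => rw [hx]
      simp only [inner_add_right, real_inner_smul_right]
    rw [hA]
    simp only [inner_sub_left, inner_add_left, real_inner_smul_left]
    rw [q a', q b', q c', haa, hbb, hcc, eq_neg_of_add_eq_zero_left hab,
      eq_neg_of_add_eq_zero_left hbc, eq_neg_of_add_eq_zero_left hca]
    ring
  · rw [hA, g1a, g2a, g3a, hNa]; simp
  · rw [hA, g1b, g2b, g3b, hNb]; simp
  · rw [hA, g1c, g2c, g3c, hNc]; simp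

/-- If the form `det4 a X c` vanishes, then `X` is in the span of `a` and `c`. -/
lemma inner_eq_zero_of_det4 {a X c z q y : E4} (h : det4 a z c q ≠ 0)
    (hX : ∀ x, det4 a X c x = 0) (ha : ⟪y, a⟫ = 0) (hc : ⟪y, c⟫ = 0) : ⟪y, X⟫ = 0 := by
  have := congrArg (fun v => ⟪y, v⟫) (cramer4 a z c q X)
  have e : det4 a z c X = -det4 a X c z := by simp only [det4_eq]; ring
  simp only [inner_add_right, real_inner_smul_right, ha, hc, hX, e, mul_zero, zero_mul, neg_zero,
    add_zero] at this
  exact (mul_eq_zero.1 this).resolve_left h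

lemma exists_eq_smul_of_det4 {a X b c d : E4} (h : det4 a b c d ≠ 0)
    (hX : ∀ x y, det4 a X x y = 0) : ∃ r : ℝ, X = r • a := by
  have e1 : det4 a b X d = -det4 a X b d := det4_swap₂ a X b d
  have e2 : det4 a b c X = det4 a X b c := by simp only [det4_eq]; ring
  have := cramer4 a b c d X
  rw [e1, e2, hX, hX, hX] at this
  simp only [neg_zero, zero_smul, add_zero] at this
  refine ⟨det4 X b c d / det4 a b c d, ?_⟩
  apply smul_right_injective E4 h
  simp only [smul_smul]
  rw [this]; congr 1; field_simp

/-- The discrete Minkowski inequality for a convex polygon, in a form which does not mention the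
polygon: `φ` is the cyclic successor on the set `J` of edges, the vertex `j` joins the edges `j` and
`φ j`, and `h`, `f`, `g` are the support numbers of the vertex functions `ξ`, `1`, `ψ`. -/
lemma polygon_form {ι : Type*} (J : Finset ι) (φ φ' : ι → ι)
    (hφ : ∀ j ∈ J, φ j ∈ J) (hφ' : ∀ j ∈ J, φ' j ∈ J)
    (hl : ∀ j ∈ J, φ' (φ j) = j) (hr : ∀ j ∈ J, φ (φ' j) = j)
    (a P ξ ψ s t h f g : ι → ℝ)
    (ha : ∀ j ∈ J, a j ≠ 0) (hP : ∀ j ∈ J, 0 < P j)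
    (hs : ∀ j ∈ J, ξ j - ξ (φ' j) = s j * a j) (ht : ∀ j ∈ J, ψ j - ψ (φ' j) = t j * a j)
    (hh : ∀ j ∈ J, a (φ j) * h j - a j * h (φ j) = P j * ξ j)
    (hf : ∀ j ∈ J, a (φ j) * f j - a j * f (φ j) = P j)
    (hg : ∀ j ∈ J, a (φ j) * g j - a j * g (φ j) = P j * ψ j)
    (hsf : ∑ j ∈ J, s j * f j = 0) (hsg : ∑ j ∈ J, s j * g j = 0)
    (htf : ∑ j ∈ J, t j * f j = 0) (htg : ∑ j ∈ J, t j * g j < 0)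
    (M m : ι) (hMm : ψ M ≠ ψ m) (hbad : ∀ j ∈ J, a j * a (φ j) < 0 → j = M ∨ j = m) :
    0 ≤ ∑ j ∈ J, s j * h j ∧ (∑ j ∈ J, s j * h j = 0 → ∀ j ∈ J, s j = 0) := by
  have shift : ∀ F : ι → ℝ, ∑ j ∈ J, F (φ' j) = ∑ j ∈ J, F j := fun F =>
    Finset.sum_nbij' φ' φ hφ' hφ hr hl (fun _ _ => rfl)
  have parts : ∀ x y k r : ι → ℝ, (∀ j ∈ J, x j - x (φ' j) = r j * a j) →
      (∀ j ∈ J, a (φ j) * k j - a j * k (φ j) = P j * y j) →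
      ∑ j ∈ J, x j * y j * (P j / (a j * a (φ j))) = ∑ j ∈ J, r j * k j := by
    intro x y k r hx hk
    have h1 : ∑ j ∈ J, r j * k j = ∑ j ∈ J, (x j * (k j / a j) - x (φ' j) * (k j / a j)) := by
      refine Finset.sum_congr rfl fun j hj => ?_
      have h0 := ha j hj
      rw [← sub_mul, hx j hj]; field_simp
    have h2 : ∑ j ∈ J, x (φ' j) * (k j / a j) = ∑ j ∈ J, x j * (k (φ j) / a (φ j)) := by
      rw [← shift fun j => x j * (k (φ j) / a (φ j))]
      refine Finset.sum_congr rfl fun j hj => ?_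
      rw [hr j hj]
    rw [h1, Finset.sum_sub_distrib, h2, ← Finset.sum_sub_distrib]
    refine Finset.sum_congr rfl fun j hj => ?_
    have h0 := ha j hj
    have h0' := ha _ (hφ j hj)
    have := hk j hj
    field_simp
    linear_combination (-x j) * this
  have B1 := parts ξ ξ h s hs hh
  have B2 := parts ξ (fun _ => 1) f s hs (by simpa using hf)
  have B3 := parts ξ ψ g s hs hg
  have B4 := parts ψ (fun _ => 1) f t ht (by simpa using hf)
  have B5 := parts ψ ψ g t ht hg
  have B6 := parts (fun _ => 1) (fun _ => 1) f (fun _ => 0) (by simp) (by simpa using hf)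
  simp only [mul_one, one_mul, zero_mul, Finset.sum_const_zero] at B2 B4 B6
  rw [hsf] at B2
  rw [hsg] at B3
  rw [htf] at B4
  set x := (ξ M - ξ m) / (ψ M - ψ m) with hx
  set y := ξ M - x * ψ M with hy
  have hM : ξ M - x * ψ M - y = 0 := by rw [hy]; ring
  have hm : ξ m - x * ψ m - y = 0 := by
    have : ψ M - ψ m ≠ 0 := sub_ne_zero.2 hMm
    rw [hy, hx]; field_simp; ring
  have expand : ∑ j ∈ J, (ξ j - x * ψ j - y) ^ 2 * (P j / (a j * a (φ j))) =
      ∑ j ∈ J, s j * h j + x ^ 2 * ∑ j ∈ J, t j * g j := by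
    have : ∀ j, (ξ j - x * ψ j - y) ^ 2 * (P j / (a j * a (φ j))) =
        ξ j * ξ j * (P j / (a j * a (φ j))) + x ^ 2 * (ψ j * ψ j * (P j / (a j * a (φ j))))
        + y ^ 2 * (P j / (a j * a (φ j)))
        - 2 * x * (ξ j * ψ j * (P j / (a j * a (φ j))))
        - 2 * y * (ξ j * (P j / (a j * a (φ j))))
        + 2 * x * y * (ψ j * (P j / (a j * a (φ j)))) := fun j => by ring
    rw [Finset.sum_congr rfl fun j _ => this j]
    simp only [Finset.sum_add_distrib, Finset.sum_sub_distrib]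
    simp only [← Finset.mul_sum]
    rw [B1, B2, B3, B4, B5, B6]
    ring
  have term : ∀ j ∈ J, 0 ≤ (ξ j - x * ψ j - y) ^ 2 * (P j / (a j * a (φ j))) ∧
      ((ξ j - x * ψ j - y) ^ 2 * (P j / (a j * a (φ j))) = 0 → ξ j - x * ψ j - y = 0) := by
    intro j hj
    have h0 : a j * a (φ j) ≠ 0 := mul_ne_zero (ha j hj) (ha _ (hφ j hj))
    rcases lt_or_gt_of_ne h0 with hlt | hgt
    · rcases hbad j hj hlt with rfl | rfl
      · rw [hM]; simp
      · rw [hm]; simp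
    · have hpos : 0 < P j / (a j * a (φ j)) := div_pos (hP j hj) hgt
      refine ⟨by positivity, fun h1 => ?_⟩
      rcases mul_eq_zero.1 h1 with h2 | h2
      · exact pow_eq_zero_iff (two_ne_zero) |>.1 h2
      · exact absurd h2 hpos.ne'
  have hnn := Finset.sum_nonneg fun j hj => (term j hj).1
  have hx2 : x ^ 2 * ∑ j ∈ J, t j * g j ≤ 0 := mul_nonpos_of_nonneg_of_nonpos (sq_nonneg x) htg.le
  refine ⟨by linarith, fun h0 => ?_⟩
  have hx0 : x = 0 := by
    have : x ^ 2 * ∑ j ∈ J, t j * g j = 0 := by linarith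
    rcases mul_eq_zero.1 this with h1 | h1
    · exact pow_eq_zero_iff two_ne_zero |>.1 h1
    · exact absurd h1 htg.ne
  have hconst : ∀ j ∈ J, ξ j = y := by
    intro j hj
    have h1 := (Finset.sum_eq_zero_iff_of_nonneg fun j hj => (term j hj).1).1
      (by rw [expand, h0, hx0]; simp) j hj
    have h2 := (term j hj).2 h1
    rw [hx0] at h2; linarith
  intro j hj
  have := hs j hj
  rw [hconst j hj, hconst _ (hφ' j hj), sub_self] at this
  exact (mul_eq_zero.1 this.symm).resolve_right (ha j hj)

section Cone

variable {n : ℕ} {u : Fin n → E4} {p : E4}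

/-- The polyhedral cone with outward normals `u i`. -/
def polyCone (u : Fin n → E4) : Set E4 := {x | ∀ i, ⟪x, u i⟫ ≤ 0}

/-- The facets `i`, `j`, `k` meet in an extreme ray, positively oriented. -/
def VertexFlag (u : Fin n → E4) (i j k : Fin n) : Prop :=
  cross3 (u i) (u j) (u k) ∈ polyCone u ∧ cross3 (u i) (u j) (u k) ≠ 0

/-- `p` is positive on the cone, and every vertex lies on just three facets. -/
structure IsSimpleCone (u : Fin n → E4) (p : E4) : Prop where
  pos : ∀ x ∈ polyCone u, x ≠ 0 → 0 < ⟪x, p⟫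
  simple : ∀ i j k l, VertexFlag u i j k → ⟪cross3 (u i) (u j) (u k), u l⟫ = 0 →
    l = i ∨ l = j ∨ l = k

lemma VertexFlag.rotate {i j k : Fin n} (h : VertexFlag u i j k) : VertexFlag u j k i := by
  rwa [VertexFlag, cross3_rotate]

lemma VertexFlag.ne₁ {i j k : Fin n} (h : VertexFlag u i j k) : i ≠ j := by
  rintro rfl
  exact (det4_cross3_pos h.2).ne' (det4_self₁ _ _ _)

lemma VertexFlag.ne₂ {i j k : Fin n} (h : VertexFlag u i j k) : j ≠ k := h.rotate.ne₁

lemma VertexFlag.ne₃ {i j k : Fin n} (h : VertexFlag u i j k) : k ≠ i := h.rotate.rotate.ne₁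

lemma VertexFlag.det4_nonpos {i j k : Fin n} (h : VertexFlag u i j k) (l : Fin n) :
    det4 (u i) (u j) (u k) (u l) ≤ 0 := h.1 l

lemma exists_mem_polyCone_add_smul {x d : E4} (hu : IsSimpleCone u p) (hx : x ∈ polyCone u)
    (hd : d ≠ 0) (hdp : ⟪d, p⟫ = 0) :
    ∃ t : ℝ, 0 ≤ t ∧ x + t • d ∈ polyCone u ∧
      ∃ l, 0 < ⟪d, u l⟫ ∧ ⟪x + t • d, u l⟫ = 0 := by
  classical
  let S := Finset.univ.filter fun l => 0 < ⟪d, u l⟫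
  have hS : S.Nonempty := by
    by_contra hne
    rw [Finset.not_nonempty_iff_eq_empty, Finset.filter_eq_empty_iff] at hne
    exact (hu.pos d (fun i => not_lt.1 (hne (Finset.mem_univ i))) hd).ne' hdp
  obtain ⟨l, hl, hmin⟩ := S.exists_min_image (fun l => -⟪x, u l⟫ / ⟪d, u l⟫) hS
  have hl' : 0 < ⟪d, u l⟫ := (Finset.mem_filter.1 hl).2
  have ht : 0 ≤ -⟪x, u l⟫ / ⟪d, u l⟫ := div_nonneg (neg_nonneg.2 (hx l)) hl'.le
  refine ⟨-⟪x, u l⟫ / ⟪d, u l⟫, ht, fun m => ?_, l, hl', ?_⟩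
  · rw [inner_add_left, real_inner_smul_left]
    rcases le_or_gt ⟪d, u m⟫ 0 with hm | hm
    · have := mul_nonpos_of_nonneg_of_nonpos ht hm
      have := hx m
      linarith
    · have := hmin m (Finset.mem_filter.2 ⟨Finset.mem_univ m, hm⟩)
      rw [le_div_iff₀ hm] at this
      linarith
  · rw [inner_add_left, real_inner_smul_left]
    field_simp
    ring

variable (hu : IsSimpleCone u p)
include hu

lemma IsSimpleCone.flag_unique {i j k k' : Fin n} (h : VertexFlag u i j k) (h' : VertexFlag u i j k') :
    k = k' := by
  have h1 := h.det4_nonpos k'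
  have h2 := h'.det4_nonpos k
  rw [det4_swap₃] at h2
  rcases hu.simple i j k k' h (by rw [inner_cross3]; linarith) with rfl | rfl | rfl
  · exact absurd rfl h'.ne₃
  · exact absurd rfl h'.ne₂
  · rfl

lemma IsSimpleCone.inner_neg {i j k l : Fin n} (h : VertexFlag u i j k) (hi : l ≠ i) (hj : l ≠ j)
    (hk : l ≠ k) : ⟪cross3 (u i) (u j) (u k), u l⟫ < 0 := by
  refine lt_of_le_of_ne (h.1 l) fun h0 => ?_
  rcases hu.simple i j k l h h0 with h1 | h1 | h1 <;> contradiction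

lemma IsSimpleCone.det4_pos {i j k : Fin n} (h : VertexFlag u i j k) :
    0 < det4 (u i) (u j) (u k) p := hu.pos _ h.1 h.2

lemma IsSimpleCone.exists_flag_swap {i j k : Fin n} (h : VertexFlag u i j k) :
    ∃ k', VertexFlag u j i k' := by
  have hP := hu.det4_pos h
  -- the direction of the edge, leaving the facet `k`
  have e1 : det4 (u i) (u j) p (u k) = -det4 (u i) (u j) (u k) p := det4_swap₃ _ _ _ _
  have hd : cross3 (u i) (u j) p ≠ 0 :=
    cross3_ne_zero_of_det4 (d := u k) (by rw [e1]; exact neg_ne_zero.2 hP.ne')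
  obtain ⟨t, ht, hx, l, hl, hxl⟩ := exists_mem_polyCone_add_smul hu h.1 hd (det4_self₃ _ _ _)
  rw [inner_cross3] at hl
  have hli : l ≠ i := by rintro rfl; rw [det4_self₁₄] at hl; exact lt_irrefl _ hl
  have hlj : l ≠ j := by rintro rfl; rw [det4_self₂₄] at hl; exact lt_irrefl _ hl
  have hlk : l ≠ k := by rintro rfl; rw [e1] at hl; linarith
  have hneg := hu.inner_neg h hli hlj hlk
  rw [inner_cross3] at hneg
  have e2 : det4 (u j) (u i) (u l) (u k) = det4 (u i) (u j) (u k) (u l) := by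
    rw [det4_swap₁, det4_swap₃, neg_neg]
  have hN : cross3 (u j) (u i) (u l) ≠ 0 :=
    cross3_ne_zero_of_det4 (d := u k) (by rw [e2]; exact hneg.ne)
  set x := cross3 (u i) (u j) (u k) + t • cross3 (u i) (u j) p with hxdef
  have hxi : ⟪x, u i⟫ = 0 := by
    simp [hxdef, inner_add_left, real_inner_smul_left, inner_cross3, det4_self₁₄]
  have hxj : ⟪x, u j⟫ = 0 := by
    simp [hxdef, inner_add_left, real_inner_smul_left, inner_cross3, det4_self₂₄]
  have hxk : ⟪x, u k⟫ = t * -det4 (u i) (u j) (u k) p := by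
    simp [hxdef, inner_add_left, real_inner_smul_left, inner_cross3, det4_self₃, e1]
  have hxp : 0 < ⟪x, p⟫ := by
    simp [hxdef, inner_add_left, real_inner_smul_left, inner_cross3, det4_self₃, hP]
  obtain ⟨r, hr⟩ := eq_smul_cross3 hN hxj hxi hxl
  have hr0 : r ≠ 0 := by rintro rfl; rw [hr] at hxp; simp at hxp
  have hrk : r * det4 (u i) (u j) (u k) (u l) = t * -det4 (u i) (u j) (u k) p := by
    rw [← hxk, hr, real_inner_smul_left, inner_cross3, e2]
  have hrpos : 0 < r := by
    refine lt_of_le_of_ne ?_ hr0.symm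
    by_contra hlt
    nlinarith [mul_pos_of_neg_of_neg (not_le.1 hlt) hneg, mul_nonneg ht hP.le]
  refine ⟨l, fun m => ?_, hN⟩
  have := hx m
  rw [hr, real_inner_smul_left] at this
  exact nonpos_of_mul_nonpos_right this hrpos

/-- Every nonzero point of a facet can be moved to a vertex of that facet. -/
lemma IsSimpleCone.exists_flag {i : Fin n} {x : E4} (hx : x ∈ polyCone u) (hx0 : x ≠ 0)
    (hxi : ⟪x, u i⟫ = 0) (hui : u i ≠ 0) : ∃ j k, VertexFlag u i j k := by
  have hxp := hu.pos x hx hx0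
  have orth : ∀ a b : E4, ∃ d : E4, d ≠ 0 ∧ ⟪d, p⟫ = 0 ∧ ⟪d, a⟫ = 0 ∧ ⟪d, b⟫ = 0 := by
    intro a b
    let f : E4 →ₗ[ℝ] (Fin 3 → ℝ) := LinearMap.pi ![innerₗ E4 p, innerₗ E4 a, innerₗ E4 b]
    have hk : 0 < Module.finrank ℝ (LinearMap.ker f) := by
      have h1 := f.finrank_range_add_finrank_ker
      have h2 := (LinearMap.range f).finrank_le
      simp at h1 h2
      omega
    obtain ⟨d, hd⟩ := Module.finrank_pos_iff_exists_ne_zero.1 hk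
    refine ⟨d, by simpa using hd, ?_, ?_, ?_⟩
    · have := congrFun d.2 0
      rw [real_inner_comm]; simpa [f] using this
    · have := congrFun d.2 1
      rw [real_inner_comm]; simpa [f] using this
    · have := congrFun d.2 2
      rw [real_inner_comm]; simpa [f] using this
  obtain ⟨d, hd0, hdp, hdi, -⟩ := orth (u i) (u i)
  obtain ⟨t, -, hy, j, hdj, hyj⟩ := exists_mem_polyCone_add_smul hu hx hd0 hdp
  obtain ⟨d', hd0', hdp', hdi', hdj'⟩ := orth (u i) (u j)
  obtain ⟨t', -, hz, k, hdk', hzk⟩ := exists_mem_polyCone_add_smul hu hy hd0' hdp'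
  set z := x + t • d + t' • d' with hzdef
  have hzp : 0 < ⟪z, p⟫ := by
    simp [hzdef, inner_add_left, real_inner_smul_left, hdp, hdp', hxp]
  have hzi : ⟪z, u i⟫ = 0 := by
    simp [hzdef, inner_add_left, real_inner_smul_left, hdi, hdi', hxi]
  have hzj : ⟪z, u j⟫ = 0 := by
    rw [hzdef, inner_add_left, hyj, real_inner_smul_left, hdj']; simp
  have hN : cross3 (u i) (u j) (u k) ≠ 0 := by
    intro h0
    have hD : ∀ x, det4 (u i) (u j) (u k) x = 0 := fun x => by rw [det4, h0, inner_zero_left]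
    have hD2 : ∀ x y, det4 (u i) (u j) x y = 0 := fun x y => by
      have := congrArg (fun v => ⟪d', v⟫) (five_term (u i) (u j) (u k) x y)
      simpa [inner_sub_right, inner_add_right, real_inner_smul_right, hdi', hdj', hD, hdk'.ne']
        using this
    have hD3 : ∀ x y z, det4 (u i) x y z = 0 := fun x y z => by
      have := congrArg (fun v => ⟪d, v⟫) (five_term (u i) (u j) x y z)
      simpa [inner_sub_right, inner_add_right, real_inner_smul_right, hdi, hD2, hdj.ne']
        using this
    exact hui (eq_zero_of_det4_eq_zero hD3)
  obtain ⟨r, hr⟩ := eq_smul_cross3 hN hzi hzj hzk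
  rcases lt_trichotomy r 0 with hr0 | hr0 | hr0
  · have hF : VertexFlag u j i k := by
      refine ⟨fun m => ?_, by rw [cross3_swap₁]; exact neg_ne_zero.2 hN⟩
      have := hz m
      rw [hr, real_inner_smul_left] at this
      rw [cross3_swap₁, inner_neg_left]
      nlinarith
    exact ⟨k, j, hF.rotate⟩
  · rw [hr, hr0] at hzp; simp at hzp
  · refine ⟨j, k, fun m => ?_, hN⟩
    have := hz m
    rw [hr, real_inner_smul_left] at this
    exact nonpos_of_mul_nonpos_right this hr0

end Cone

section Facet

variable {n : ℕ} {u : Fin n → E4} {p : E4}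

/-- The facets `i` and `j` share an edge. -/
def IsEdge (u : Fin n → E4) (i j : Fin n) : Prop := ∃ k, VertexFlag u i j k

open Classical in
/-- The third facet at the endpoint of the oriented edge `(i, j)`. -/
noncomputable def third (u : Fin n → E4) (i j : Fin n) : Fin n :=
  if h : IsEdge u i j then h.choose else i

lemma IsEdge.flag {i j : Fin n} (h : IsEdge u i j) : VertexFlag u i j (third u i j) := by
  rw [third, dif_pos h]; exact h.choose_spec

variable (hu : IsSimpleCone u p)
include hu

lemma IsSimpleCone.third_eq {i j k : Fin n} (h : VertexFlag u i j k) : third u i j = k :=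
  hu.flag_unique (IsEdge.flag ⟨k, h⟩) h

lemma IsSimpleCone.edge_symm {i j : Fin n} (h : IsEdge u i j) : IsEdge u j i :=
  hu.exists_flag_swap h.flag

lemma IsSimpleCone.edge_third {i j : Fin n} (h : IsEdge u i j) : IsEdge u i (third u i j) :=
  hu.edge_symm ⟨j, h.flag.rotate.rotate⟩

lemma IsSimpleCone.edge_third' {i j : Fin n} (h : IsEdge u i j) : IsEdge u i (third u j i) :=
  ⟨j, (hu.edge_symm h).flag.rotate⟩

lemma IsSimpleCone.third_third {i j : Fin n} (h : IsEdge u i j) :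
    third u (third u i j) i = j := hu.third_eq h.flag.rotate.rotate

lemma IsSimpleCone.third_third' {i j : Fin n} (h : IsEdge u i j) :
    third u i (third u j i) = j := hu.third_eq (hu.edge_symm h).flag.rotate

lemma IsSimpleCone.not_flag_swap {i j k : Fin n} (h : VertexFlag u i j k) :
    ¬ VertexFlag u i k j := by
  intro h'
  have h1 := hu.det4_pos h
  have h2 := hu.det4_pos h'
  rw [det4_swap₂] at h2
  linarith

open Classical in
/-- The quadratic form attached to a facet is nonnegative, and vanishes only if the stress does. -/
lemma IsSimpleCone.facet_form (i : Fin n) (hi : ∃ j, IsEdge u i j) (q : E4)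
    (hq : ∀ j, IsEdge u i j → det4 (u i) (u j) p q ≠ 0) (w : Fin n → E4)
    (B : Fin n → E4 →ₗ[ℝ] E4) (s : Fin n → ℝ) (hskew : ∀ j, IsEdge u i j → IsSkew (B j))
    (hBi : ∀ j, IsEdge u i j → B j (u i) = w i) (hBj : ∀ j, IsEdge u i j → B j (u j) = w j)
    (hBk : ∀ j, IsEdge u i j → B j (u (third u i j)) = w (third u i j))
    (hjump : ∀ j, IsEdge u i j → ∀ x y,
      ⟪(B j - B (third u j i)) x, y⟫ = s j * det4 (u i) (u j) x y) :
    ∃ c : ℝ, ∑ j with IsEdge u i j, s j • u j = -(c • u i) ∧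
      0 ≤ ∑ j with IsEdge u i j, s j * -⟪p, w j⟫ + c * -⟪p, w i⟫ ∧
      (∑ j with IsEdge u i j, s j * -⟪p, w j⟫ + c * -⟪p, w i⟫ = 0 →
        ∀ j, IsEdge u i j → s j = 0) := by
  obtain ⟨j₀, hj₀⟩ := hi
  have ha₀ := hq j₀ hj₀
  set J : Finset (Fin n) := Finset.univ.filter fun j => IsEdge u i j with hJ
  have mem : ∀ {j}, j ∈ J ↔ IsEdge u i j := by simp [hJ]
  have hφ : ∀ j ∈ J, third u i j ∈ J := fun j hj => mem.2 (hu.edge_third (mem.1 hj))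
  have hφ' : ∀ j ∈ J, third u j i ∈ J := fun j hj => mem.2 (hu.edge_third' (mem.1 hj))
  have hl : ∀ j ∈ J, third u (third u i j) i = j := fun j hj => hu.third_third (mem.1 hj)
  have hr : ∀ j ∈ J, third u i (third u j i) = j := fun j hj => hu.third_third' (mem.1 hj)
  have shift : ∀ F : Fin n → ℝ, ∑ j ∈ J, F (third u j i) = ∑ j ∈ J, F j := fun F =>
    Finset.sum_nbij' (fun j => third u j i) (fun j => third u i j) hφ' hφ hr hl (fun _ _ => rfl)
  -- the stress is in equilibrium
  obtain ⟨r, hr'⟩ : ∃ r : ℝ, ∑ j ∈ J, s j • u j = r • u i := by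
    refine exists_eq_smul_of_det4 ha₀ fun x y => ?_
    rw [det4_sum₂]
    have : ∀ j ∈ J, s j * det4 (u i) (u j) x y = ⟪B j x, y⟫ - ⟪B (third u j i) x, y⟫ := by
      intro j hj
      rw [← hjump j (mem.1 hj), LinearMap.sub_apply, inner_sub_left]
    rw [Finset.sum_congr rfl this, Finset.sum_sub_distrib, shift fun j => ⟪B j x, y⟫, sub_self]
  refine ⟨-r, by rw [hr']; simp, ?_⟩
  -- dual vectors
  have e1 : det4 p (u i) (u j₀) q = det4 (u i) (u j₀) p q := by simp only [det4_eq]; ring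
  have e2 : det4 q (u i) (u j₀) p = -det4 (u i) (u j₀) p q := by simp only [det4_eq]; ring
  obtain ⟨y, yi, -, yp, yq⟩ := exists_dual ha₀
  obtain ⟨o, op, oi, -, oq⟩ := exists_dual (by rw [e1]; exact ha₀)
  obtain ⟨o', oq', oi', -, op'⟩ := exists_dual (by rw [e2]; exact neg_ne_zero.2 ha₀)
  -- the vertices
  let N : Fin n → E4 := fun j => cross3 (u i) (u j) (u (third u i j))
  let V : Fin n → E4 := fun j => (⟪N j, p⟫)⁻¹ • N j
  have hNp : ∀ j ∈ J, 0 < ⟪N j, p⟫ := fun j hj => hu.det4_pos (mem.1 hj).flag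
  have hVp : ∀ j ∈ J, ⟪V j, p⟫ = 1 := fun j hj => by
    simp only [V, real_inner_smul_left]; exact inv_mul_cancel₀ (hNp j hj).ne'
  have hVi : ∀ j, ⟪V j, u i⟫ = 0 := fun j => by
    simp only [V, N, real_inner_smul_left, inner_cross3, det4_self₁₄, mul_zero]
  have hVj : ∀ j, ⟪V j, u j⟫ = 0 := fun j => by
    simp only [V, N, real_inner_smul_left, inner_cross3, det4_self₂₄, mul_zero]
  have hVk : ∀ j, ⟪V j, u (third u i j)⟫ = 0 := fun j => by
    simp only [V, N, real_inner_smul_left, inner_cross3, det4_self₃, mul_zero]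
  have hVle : ∀ j ∈ J, ∀ l, ⟪V j, u l⟫ ≤ 0 := fun j hj l => by
    simp only [V, real_inner_smul_left]
    exact mul_nonpos_of_nonneg_of_nonpos (inv_pos.2 (hNp j hj)).le ((mem.1 hj).flag.1 l)
  have hVlt : ∀ j ∈ J, ∀ l, l ≠ i → l ≠ j → l ≠ third u i j → ⟪V j, u l⟫ < 0 := by
    intro j hj l h1 h2 h3
    simp only [V, real_inner_smul_left]
    exact mul_neg_of_pos_of_neg (inv_pos.2 (hNp j hj)) (hu.inner_neg (mem.1 hj).flag h1 h2 h3)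
  have hVj' : ∀ j ∈ J, ⟪V (third u j i), u j⟫ = 0 := fun j hj => by
    have := hVk (third u j i)
    rwa [hr j hj] at this
  have hne : ∀ j ∈ J, third u i (third u i j) ≠ j := by
    intro j hj h
    have h1 := (mem.1 (hφ j hj)).flag
    rw [h] at h1
    exact hu.not_flag_swap (mem.1 hj).flag h1
  have hne' : ∀ j ∈ J, third u i j ≠ third u j i := by
    intro j hj h
    apply hne j hj
    rw [h, hr j hj]
  have pair : ∀ (j : Fin n) (v : E4), ⟪v, u i⟫ = 0 → ⟪v, p⟫ = 0 →
      det4 (u i) (u (third u i j)) p q * ⟪v, u j⟫ -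
        det4 (u i) (u j) p q * ⟪v, u (third u i j)⟫ = ⟪N j, p⟫ * ⟪v, q⟫ := by
    intro j v hvi hvp
    have := congrArg (fun x => ⟪v, x⟫) (five_term (u i) (u j) (u (third u i j)) p q)
    change _ = det4 (u i) (u j) (u (third u i j)) p * _
    simpa only [inner_sub_right, inner_add_right, real_inner_smul_right, hvi, hvp, mul_zero,
      add_zero, sub_zero] using this
  -- the edges
  have ht' : ∀ j, ∃ t : ℝ, j ∈ J → V j - V (third u j i) = t • cross3 (u i) (u j) p := by
    intro j
    by_cases hj : j ∈ J
    · obtain ⟨t, ht⟩ := eq_smul_cross3 (x := V j - V (third u j i))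
        (cross3_ne_zero_of_det4 (hq j (mem.1 hj)))
        (by rw [inner_sub_left, hVi, hVi, sub_zero])
        (by rw [inner_sub_left, hVj, hVj' j hj, sub_zero])
        (by rw [inner_sub_left, hVp j hj, hVp _ (hφ' j hj), sub_self])
      exact ⟨t, fun _ => ht⟩
    · exact ⟨0, fun h => absurd h hj⟩
  choose t ht using ht'
  have ht_inner : ∀ j ∈ J, ∀ x, ⟪V j, x⟫ - ⟪V (third u j i), x⟫ = t j * det4 (u i) (u j) p x := by
    intro j hj x
    rw [← inner_sub_left, ht j hj, real_inner_smul_left, inner_cross3]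
  have ht_neg : ∀ j ∈ J, t j < 0 := by
    intro j hj
    have h1 := ht_inner j hj (u (third u i j))
    have hf := (mem.1 hj).flag
    have h2 := hVlt _ (hφ' j hj) (third u i j) hf.ne₃ (hne' j hj)
      (by rw [hr j hj]; exact hf.ne₂.symm)
    have h3 : 0 < det4 (u i) (u j) (u (third u i j)) p := hNp j hj
    rw [hVk, det4_swap₃] at h1
    by_contra hlt
    nlinarith [mul_nonneg (not_lt.1 hlt) h3.le]
  have hX : ∀ v : E4, ⟪v, u i⟫ = 0 → ⟪v, p⟫ = 0 → ⟪v, ∑ j ∈ J, t j • u j⟫ = 0 := by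
    intro v hvi hvp
    refine inner_eq_zero_of_det4 ha₀ (fun x => ?_) hvi hvp
    rw [det4_sum₂]
    rw [← Finset.sum_congr rfl fun j hj => ht_inner j hj x, Finset.sum_sub_distrib,
      shift fun j => ⟪V j, x⟫, sub_self]
  -- support numbers
  have hinner : ∀ (f : Fin n → ℝ) (v : E4),
      ∑ j ∈ J, f j * ⟪v, u j⟫ = ⟪v, ∑ j ∈ J, f j • u j⟫ := by
    intro f v
    rw [inner_sum]
    exact Finset.sum_congr rfl fun j _ => (real_inner_smul_right _ _ _).symm
  have htg : ∑ j ∈ J, t j * -⟪o, u j⟫ < 0 := by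
    have hj : j₀ ∈ J := mem.2 hj₀
    have h1 : ∑ j ∈ J, t j * -⟪o, u j⟫ = -∑ j ∈ J, t j * ⟪V j₀, u j⟫ := by
      have := hX (o - V j₀) (by rw [inner_sub_left, oi, hVi, sub_zero])
        (by rw [inner_sub_left, op, hVp _ hj, sub_self])
      rw [inner_sub_left, ← hinner, ← hinner] at this
      simp only [mul_neg, Finset.sum_neg_distrib]
      linarith
    rw [h1, neg_lt_zero]
    refine Finset.sum_pos' (fun j hj' =>
      mul_nonneg_of_nonpos_of_nonpos (ht_neg j hj').le (hVle _ hj j))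
      ⟨_, hφ _ (hφ _ hj), mul_pos_of_neg_of_neg (ht_neg _ (hφ _ (hφ _ hj))) ?_⟩
    have hf := (mem.1 (hφ _ hj)).flag
    exact hVlt _ hj _ hf.ne₃ (hne _ hj) hf.ne₂.symm
  obtain ⟨M, hM, hmax⟩ := J.exists_max_image (fun j => ⟪V j, q⟫) ⟨j₀, mem.2 hj₀⟩
  obtain ⟨m, hm, hmin⟩ := J.exists_min_image (fun j => ⟪V j, q⟫) ⟨j₀, mem.2 hj₀⟩
  have hMm : ⟪V M, q⟫ ≠ ⟪V m, q⟫ := by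
    intro h
    have hj : j₀ ∈ J := mem.2 hj₀
    have h1 := ht_inner j₀ hj q
    have h2 := hmax _ hj
    have h3 := hmin _ hj
    have h4 := hmax _ (hφ' _ hj)
    have h5 := hmin _ (hφ' _ hj)
    have : t j₀ * det4 (u i) (u j₀) p q = 0 := by linarith
    rcases mul_eq_zero.1 this with h6 | h6
    · exact (ht_neg _ hj).ne h6
    · exact ha₀ h6
  have same : ∀ j ∈ J, ∀ l ∈ J, ⟪V l, u j⟫ = 0 → ⟪V l, u (third u i j)⟫ = 0 → j = l := by
    intro j hj l hl' h1 h2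
    have hf := (mem.1 hj).flag
    by_contra hjl
    have h3 : j = third u i l := by
      by_contra h3
      exact (hVlt l hl' j hf.ne₁.symm hjl h3).ne h1
    have h4 : third u i j = l := by
      by_contra h4
      exact (hVlt l hl' _ hf.ne₃ h4 (by rw [← h3]; exact hf.ne₂.symm)).ne h2
    rw [h3] at h4
    exact hne l hl' h4
  have hbad : ∀ j ∈ J, det4 (u i) (u j) p q * det4 (u i) (u (third u i j)) p q < 0 →
      j = M ∨ j = m := by
    intro j hj hneg
    have diff : ∀ l ∈ J, det4 (u i) (u (third u i j)) p q * ⟪V l, u j⟫ -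
        det4 (u i) (u j) p q * ⟪V l, u (third u i j)⟫ = ⟪N j, p⟫ * (⟪V l, q⟫ - ⟪V j, q⟫) := by
      intro l hl'
      have := pair j (V l - V j) (by rw [inner_sub_left, hVi, hVi, sub_zero])
        (by rw [inner_sub_left, hVp l hl', hVp j hj, sub_self])
      simpa only [inner_sub_left, hVj, hVk, sub_zero] using this
    rcases mul_neg_iff.1 hneg with ⟨h1, h2⟩ | ⟨h1, h2⟩
    · right
      have h3 := diff m hm
      have h4 := mul_nonneg_of_nonpos_of_nonpos h2.le (hVle m hm j)
      have h5 := mul_nonpos_of_nonneg_of_nonpos h1.le (hVle m hm (third u i j))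
      have h6 := mul_nonpos_of_nonneg_of_nonpos (hNp j hj).le (sub_nonpos.2 (hmin j hj))
      refine same j hj m hm ?_ ?_
      · exact (mul_eq_zero.1 (le_antisymm (by linarith) h4)).resolve_left h2.ne
      · exact (mul_eq_zero.1 (le_antisymm h5 (by linarith))).resolve_left h1.ne'
    · left
      have h3 := diff M hM
      have h4 := mul_nonpos_of_nonneg_of_nonpos h2.le (hVle M hM j)
      have h5 := mul_nonneg_of_nonpos_of_nonpos h1.le (hVle M hM (third u i j))
      have h6 := mul_nonneg (hNp j hj).le (sub_nonneg.2 (hmax j hj))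
      refine same j hj M hM ?_ ?_
      · exact (mul_eq_zero.1 (le_antisymm h4 (by linarith))).resolve_left h2.ne'
      · exact (mul_eq_zero.1 (le_antisymm (by linarith) h5)).resolve_left h1.ne
  have main := polygon_form J (fun j => third u i j) (fun j => third u j i) hφ hφ' hl hr
    (fun j => det4 (u i) (u j) p q) (fun j => ⟪N j, p⟫) (fun j => ⟪B j p, q⟫) (fun j => ⟪V j, q⟫)
    s t (fun j => -⟪p, w j⟫ - -⟪p, w i⟫ * ⟪y, u j⟫) (fun j => ⟪o', u j⟫) (fun j => -⟪o, u j⟫)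
    (fun j hj => hq j (mem.1 hj)) hNp
    (fun j hj => by rw [← hjump j (mem.1 hj), LinearMap.sub_apply, inner_sub_left])
    (fun j hj => ht_inner j hj q)
    (fun j hj => by
      have hj' := mem.1 hj
      have hB : ∀ x, ⟪B j p, x⟫ = -⟪p, B j x⟫ := hskew j hj' p
      have := pair j (B j p - (-⟪p, w i⟫) • y)
        (by rw [inner_sub_left, real_inner_smul_left, yi, hB, hBi j hj']; ring)
        (by rw [inner_sub_left, real_inner_smul_left, yp, (hskew j hj').inner_self]; ring)
      simpa only [inner_sub_left, real_inner_smul_left, yq, mul_zero, sub_zero, hB (u j),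
        hB (u (third u i j)), hBj j hj', hBk j hj'] using this)
    (fun j _ => by simpa only [oq', mul_one] using pair j o' oi' op')
    (fun j hj => by
      have := pair j (V j - o) (by rw [inner_sub_left, oi, hVi, sub_zero])
        (by rw [inner_sub_left, op, hVp j hj, sub_self])
      simpa only [inner_sub_left, hVj, hVk, oq, sub_zero, zero_sub] using this)
    (by rw [hinner, hr', real_inner_smul_right, oi', mul_zero])
    (by simp only [mul_neg, Finset.sum_neg_distrib]
        rw [hinner, hr', real_inner_smul_right, oi, mul_zero, neg_zero])
    (by rw [hinner]; exact hX o' oi' op') htg M m hMm hbad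
  have hG : ∑ j ∈ J, s j * (-⟪p, w j⟫ - -⟪p, w i⟫ * ⟪y, u j⟫) =
      ∑ j ∈ J, s j * -⟪p, w j⟫ + -r * -⟪p, w i⟫ := by
    have h1 : ∑ j ∈ J, s j * ⟪y, u j⟫ = r := by
      rw [hinner, hr', real_inner_smul_right, yi, mul_one]
    have h2 : ∀ j ∈ J, s j * (-⟪p, w j⟫ - -⟪p, w i⟫ * ⟪y, u j⟫) =
        s j * -⟪p, w j⟫ + ⟪p, w i⟫ * (s j * ⟪y, u j⟫) := fun j _ => by ring
    rw [Finset.sum_congr rfl h2, Finset.sum_add_distrib, ← Finset.mul_sum, h1]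
    ring
  rw [hG] at main
  exact ⟨main.1, fun h j hj => main.2 h j (mem.2 hj)⟩

end Facet

section Rigidity

variable {n : ℕ} {u w : Fin n → E4} {p : E4}

/-- `A i j` is the infinitesimal rotation inducing `w` at the endpoint of the oriented edge
`(i, j)`. -/
def IsLocalRotation (u w : Fin n → E4) (A : Fin n → Fin n → E4 →ₗ[ℝ] E4) : Prop :=
  ∀ i j k, VertexFlag u i j k →
    IsSkew (A i j) ∧ A i j (u i) = w i ∧ A i j (u j) = w j ∧ A i j (u k) = w k

lemma IsLocalRotation.rotate {A : Fin n → Fin n → E4 →ₗ[ℝ] E4} (hA : IsLocalRotation u w A)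
    {i j k : Fin n} (h : VertexFlag u i j k) : A i j = A j k := by
  obtain ⟨s, hi, hj, hk⟩ := hA i j k h
  obtain ⟨s', hj', hk', hi'⟩ := hA j k i h.rotate
  exact s.eq_of_eq_on s' h.2 (hi.trans hi'.symm) (hj.trans hj'.symm) (hk.trans hk'.symm)

variable (hu : IsSimpleCone u p)
include hu

lemma IsSimpleCone.exists_isLocalRotation (htan : ∀ i, ⟪u i, w i⟫ = 0)
    (hadj : ∀ i j, IsEdge u i j → ⟪w i, u j⟫ + ⟪u i, w j⟫ = 0) :
    ∃ A, IsLocalRotation u w A := by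
  have key : ∀ i j, ∃ A : E4 →ₗ[ℝ] E4, ∀ k, VertexFlag u i j k →
      IsSkew A ∧ A (u i) = w i ∧ A (u j) = w j ∧ A (u k) = w k := by
    intro i j
    by_cases h : IsEdge u i j
    · obtain ⟨k, hk⟩ := h
      have tan : ∀ i, ⟪w i, u i⟫ = 0 := fun i => by rw [real_inner_comm]; exact htan i
      have adj : ∀ i j, IsEdge u i j → ⟪w i, u j⟫ + ⟪w j, u i⟫ = 0 := fun i j h => by
        rw [real_inner_comm (u i) (w j)]; exact hadj i j h
      obtain ⟨A, hA⟩ := exists_isSkew hk.2 (tan i) (tan j) (tan k) (adj i j ⟨k, hk⟩)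
        (adj j k ⟨i, hk.rotate⟩) (adj k i ⟨j, hk.rotate.rotate⟩)
      refine ⟨A, fun k' hk' => ?_⟩
      rw [hu.flag_unique hk' hk]
      exact hA
    · exact ⟨0, fun k hk => absurd ⟨k, hk⟩ h⟩
  choose A hA using key
  exact ⟨A, hA⟩

variable {A : Fin n → Fin n → E4 →ₗ[ℝ] E4} (hA : IsLocalRotation u w A)

include hA in
/-- There is no jump of the rotation along any edge. -/
lemma IsSimpleCone.rotation_symm {e : E4} (he : ∀ i, ⟪e, u i⟫ < 0)
    (hfac : ∀ i, ∃ j, IsEdge u i j) {i j : Fin n} (hij : IsEdge u i j) : A i j = A j i := by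
  classical
  have jump : ∀ i j, ∃ s : ℝ, IsEdge u i j →
      ∀ x y, ⟪(A i j - A j i) x, y⟫ = s * det4 (u i) (u j) x y := by
    intro i j
    by_cases h : IsEdge u i j
    · obtain ⟨hs, hi, hj, -⟩ := hA i j _ h.flag
      obtain ⟨hs', hj', hi', -⟩ := hA j i _ (hu.edge_symm h).flag
      obtain ⟨s, hs⟩ := (hs.sub hs').exists_eq_det4 (det4_cross3_pos h.flag.2).ne'
        (by simp [hi, hi']) (by simp [hj, hj'])
      exact ⟨s, fun _ => hs⟩
    · exact ⟨0, fun h' => absurd h' h⟩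
  choose s hs using jump
  have s_symm : ∀ i j, IsEdge u i j → s i j = s j i := by
    intro i j h
    have hN := (det4_cross3_pos h.flag.2).ne'
    have h1 := hs i j h (u (third u i j)) (cross3 (u i) (u j) (u (third u i j)))
    have h2 := hs j i (hu.edge_symm h) (u (third u i j)) (cross3 (u i) (u j) (u (third u i j)))
    rw [LinearMap.sub_apply, inner_sub_left] at h1 h2
    rw [det4_swap₁] at h2
    apply mul_right_cancel₀ hN
    linarith
  obtain ⟨q, hq⟩ : ∃ q : E4, ∀ e : {e : Fin n × Fin n // IsEdge u e.1 e.2},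
      innerₗ E4 (cross3 (u e.1.1) (u e.1.2) p) q ≠ 0 := by
    refine Module.Dual.exists_forall_ne_zero_of_forall_exists
      (fun e : {e : Fin n × Fin n // IsEdge u e.1 e.2} =>
        innerₗ E4 (cross3 (u e.1.1) (u e.1.2) p)) fun e => ?_
    refine ⟨u (third u e.1.1 e.1.2), ?_⟩
    rw [innerₗ_apply_apply, inner_cross3, det4_swap₃]
    exact neg_ne_zero.2 (hu.det4_pos e.2.flag).ne'
  have form := fun i => hu.facet_form i (hfac i) q (fun j h => hq ⟨(i, j), h⟩) w (A i) (s i)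
    (fun j h => (hA i j _ h.flag).1) (fun j h => (hA i j _ h.flag).2.1)
    (fun j h => (hA i j _ h.flag).2.2.1) (fun j h => (hA i j _ h.flag).2.2.2)
    (fun j h => by
      have h' := (hu.edge_symm h).flag
      rw [← hA.rotate h']
      exact hs i j h)
  choose c hc hpos hzero using form
  set G : Fin n → ℝ := fun i =>
    ∑ j with IsEdge u i j, s i j * -⟪p, w j⟫ + c i * -⟪p, w i⟫ with hG
  have hc' : ∀ j, ∑ i with IsEdge u j i, s j i * ⟪e, u i⟫ = -(c j * ⟪e, u j⟫) := by
    intro j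
    have := congrArg (fun x => ⟪e, x⟫) (hc j)
    simpa only [inner_sum, real_inner_smul_right, inner_neg_right] using this
  have hsum : ∑ i, ⟪e, u i⟫ * G i = 0 := by
    have h1 : ∑ i, ⟪e, u i⟫ * ∑ j with IsEdge u i j, s i j * -⟪p, w j⟫ =
        ∑ j, -⟪p, w j⟫ * ∑ i with IsEdge u j i, s j i * ⟪e, u i⟫ := by
      simp only [Finset.mul_sum, Finset.sum_filter]
      rw [Finset.sum_comm]
      refine Finset.sum_congr rfl fun j _ => Finset.sum_congr rfl fun i _ => ?_
      by_cases h : IsEdge u i j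
      · rw [if_pos h, if_pos (hu.edge_symm h), s_symm i j h]; ring
      · rw [if_neg h, if_neg (fun h' => h (hu.edge_symm h')), mul_zero, mul_zero]
    simp only [hG, mul_add, Finset.sum_add_distrib]
    rw [h1, ← Finset.sum_add_distrib]
    refine Finset.sum_eq_zero fun j _ => ?_
    rw [hc']; ring
  have hGi : G i = 0 := by
    have := (Finset.sum_eq_zero_iff_of_nonpos fun i _ =>
      mul_nonpos_of_nonpos_of_nonneg (he i).le (hpos i)).1 hsum i (Finset.mem_univ i)
    exact (mul_eq_zero.1 this).resolve_left (he i).ne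
  have hsij := hzero i hGi j hij
  ext1 x
  refine ext_inner_right ℝ fun y => ?_
  have := hs i j hij x y
  rw [hsij, zero_mul, LinearMap.sub_apply, inner_sub_left] at this
  linarith

include hA in
lemma IsSimpleCone.rotation_eq (hsymm : ∀ i j, IsEdge u i j → A i j = A j i) {i₀ j₀ k₀ : Fin n}
    (h₀ : VertexFlag u i₀ j₀ k₀) {i j : Fin n} (hij : IsEdge u i j) : A i j = A i₀ j₀ := by
  classical
  set q := u i₀ + u j₀ + u k₀ with hq
  let ψ : Fin n × Fin n → ℝ := fun e =>
    -⟪cross3 (u e.1) (u e.2) (u (third u e.1 e.2)), q⟫ /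
      ⟪cross3 (u e.1) (u e.2) (u (third u e.1 e.2)), p⟫
  by_contra hne
  obtain ⟨⟨i, j⟩, hmem, hmin⟩ := (Finset.univ.filter fun e : Fin n × Fin n =>
    IsEdge u e.1 e.2 ∧ A e.1 e.2 ≠ A i₀ j₀).exists_min_image ψ ⟨(i, j), by simp [hij, hne]⟩
  obtain ⟨hij, hne⟩ : IsEdge u i j ∧ A i j ≠ A i₀ j₀ := by simpa using hmem
  have hf := hij.flag
  set k := third u i j with hk
  set N := cross3 (u i) (u j) (u k) with hN
  have hNp : 0 < ⟪N, p⟫ := hu.det4_pos hf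
  have hNq : 0 < -⟪N, q⟫ := by
    have h1 := hf.1 i₀
    have h2 := hf.1 j₀
    have h3 := hf.1 k₀
    have hsum : ⟪N, q⟫ = ⟪N, u i₀⟫ + ⟪N, u j₀⟫ + ⟪N, u k₀⟫ := by
      rw [hq, inner_add_right, inner_add_right]
    by_contra hle
    obtain ⟨hs, hi, hj, hk⟩ := hA i j _ hf
    obtain ⟨hs₀, hi₀, hj₀, hk₀⟩ := hA i₀ j₀ _ h₀
    have agree : ∀ l, ⟪N, u l⟫ = 0 → A i j (u l) = w l := by
      intro l hl
      rcases hu.simple i j k l hf hl with rfl | rfl | rfl <;> assumption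
    exact hne (hs.eq_of_eq_on hs₀ h₀.2 ((agree i₀ (by linarith)).trans hi₀.symm)
      ((agree j₀ (by linarith)).trans hj₀.symm) ((agree k₀ (by linarith)).trans hk₀.symm))
  -- moving across an edge at the vertex does not decrease `ψ`
  set r := -⟪N, q⟫ / ⟪N, p⟫ with hr
  have hr0 : 0 < r := div_pos hNq hNp
  set y := q + r • p with hy
  have hyN : ⟪N, y⟫ = 0 := by
    rw [hy, inner_add_right, real_inner_smul_right, hr]; field_simp; ring
  have step : ∀ a b c, VertexFlag u a b c → A a b = A i j →
      ∃ M : E4, ⟪M, u a⟫ = 0 ∧ ⟪M, u b⟫ = 0 ∧ ⟪M, u c⟫ < 0 ∧ ⟪M, y⟫ ≤ 0 := by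
    intro a b c h hab
    have hE : IsEdge u a b := ⟨c, h⟩
    have hE' := hu.edge_symm hE
    have hf' := hE'.flag
    refine ⟨cross3 (u b) (u a) (u (third u b a)), det4_self₂₄ _ _ _, det4_self₁₄ _ _ _,
      hu.inner_neg hf' h.ne₂.symm h.ne₃ ?_, ?_⟩
    · intro hc
      rw [← hc] at hf'
      exact hu.not_flag_swap h.rotate.rotate hf'.rotate.rotate
    · have h1 : r ≤ ψ (b, a) := hmin (b, a) (by
        simp only [Finset.mem_filter, Finset.mem_univ, true_and]
        exact ⟨hE', by rw [← hsymm a b hE, hab]; exact hne⟩)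
      have hp : 0 < ⟪cross3 (u b) (u a) (u (third u b a)), p⟫ := hu.det4_pos hf'
      simp only [ψ] at h1
      rw [le_div_iff₀ hp] at h1
      rw [hy, inner_add_right, real_inner_smul_right]
      linarith
  obtain ⟨M₁, a1, a2, a3, a4⟩ := step i j k hf rfl
  obtain ⟨M₂, b1, b2, b3, b4⟩ := step j k i hf.rotate (hA.rotate hf).symm
  obtain ⟨M₃, c1, c2, c3, c4⟩ := step k i j hf.rotate.rotate
    ((hA.rotate hf).trans (hA.rotate hf.rotate)).symm
  -- `y` is a nonnegative combination of the three normals at the vertex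
  have hD := det4_cross3_pos hf.2
  have hcr := cramer4 (u i) (u j) (u k) N y
  have hz : det4 (u i) (u j) (u k) y = 0 := hyN
  rw [hz, zero_smul, add_zero] at hcr
  set α := det4 y (u j) (u k) N
  set β := det4 (u i) y (u k) N
  set γ := det4 (u i) (u j) y N
  have comb : ∀ x : E4, det4 (u i) (u j) (u k) N * ⟪x, y⟫ =
      α * ⟪x, u i⟫ + β * ⟪x, u j⟫ + γ * ⟪x, u k⟫ := by
    intro x
    have := congrArg (fun v => ⟪x, v⟫) hcr
    simpa only [inner_add_right, real_inner_smul_right] using this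
  have hγ : 0 ≤ γ := by
    have := comb M₁
    rw [a1, a2] at this
    by_contra hlt
    nlinarith [mul_nonneg hD.le (neg_nonneg.2 a4), mul_pos_of_neg_of_neg (not_le.1 hlt) a3]
  have hα : 0 ≤ α := by
    have := comb M₂
    rw [b1, b2] at this
    by_contra hlt
    nlinarith [mul_nonneg hD.le (neg_nonneg.2 b4), mul_pos_of_neg_of_neg (not_le.1 hlt) b3]
  have hβ : 0 ≤ β := by
    have := comb M₃
    rw [c1, c2] at this
    by_contra hlt
    nlinarith [mul_nonneg hD.le (neg_nonneg.2 c4), mul_pos_of_neg_of_neg (not_le.1 hlt) c3]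
  set N₀ := cross3 (u i₀) (u j₀) (u k₀) with hN₀
  have hN₀y : 0 < ⟪N₀, y⟫ := by
    have h1 : ⟪N₀, q⟫ = 0 := by
      simp [hN₀, hq, inner_add_right, inner_cross3, det4_self₁₄, det4_self₂₄, det4_self₃]
    rw [hy, inner_add_right, h1, real_inner_smul_right, zero_add]
    exact mul_pos hr0 (hu.det4_pos h₀)
  have := comb N₀
  nlinarith [mul_pos hD hN₀y, mul_nonneg hα (neg_nonneg.2 (h₀.1 i)),
    mul_nonneg hβ (neg_nonneg.2 (h₀.1 j)), mul_nonneg hγ (neg_nonneg.2 (h₀.1 k))]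

/-- Rigidity of the cone in terms of its edges. -/
theorem IsSimpleCone.exists_rotation {e : E4} (he : ∀ i, ⟪e, u i⟫ < 0)
    (hfac : ∀ i, ∃ j, IsEdge u i j) (htan : ∀ i, ⟪u i, w i⟫ = 0)
    (hadj : ∀ i j, IsEdge u i j → ⟪w i, u j⟫ + ⟪u i, w j⟫ = 0) :
    ∃ A : E4 →ₗ[ℝ] E4, IsSkew A ∧ ∀ i, w i = A (u i) := by
  obtain ⟨A, hA⟩ := hu.exists_isLocalRotation htan hadj
  rcases isEmpty_or_nonempty (Fin n) with hn | ⟨⟨i₀⟩⟩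
  · exact ⟨0, fun x y => by simp, fun i => hn.elim i⟩
  obtain ⟨j₀, h₀⟩ := hfac i₀
  refine ⟨A i₀ j₀, (hA _ _ _ h₀.flag).1, fun i => ?_⟩
  obtain ⟨j, hij⟩ := hfac i
  rw [← hu.rotation_eq hA (fun _ _ => hu.rotation_symm hA he hfac) h₀.flag hij]
  exact (hA _ _ _ hij.flag).2.1.symm

end Rigidity

section Polyhedron

variable {n : ℕ} {u : Fin n → E4}

lemma isSimpleCone_neg_sum (hpointed : polyCone u ∩ -polyCone u = {0})
    (hsimple : ∀ R : Set E4, IsExposed ℝ (polyCone u) R →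
      Module.finrank ℝ (Submodule.span ℝ R) = 1 →
      {i : Fin n | ∀ x ∈ R, ⟪x, u i⟫ = 0}.ncard = 3) :
    IsSimpleCone u (-∑ i, u i) := by
  refine ⟨fun x hx hx0 => ?_, fun i j k l h hl => ?_⟩
  · rw [inner_neg_right, inner_sum, neg_pos]
    refine lt_of_le_of_ne (Finset.sum_nonpos fun i _ => hx i) fun h0 => hx0 ?_
    have hz := (Finset.sum_eq_zero_iff_of_nonpos fun i _ => hx i).1 h0
    have : x ∈ polyCone u ∩ -polyCone u := by
      refine ⟨hx, fun i => ?_⟩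
      rw [inner_neg_left, hz i (Finset.mem_univ i), neg_zero]
    rwa [hpointed] at this
  · set N := cross3 (u i) (u j) (u k) with hN
    have zero_mem : (0 : E4) ∈ polyCone u := fun i => by simp
    have hNi : ⟪N, u i⟫ = 0 := det4_self₁₄ _ _ _
    have hNj : ⟪N, u j⟫ = 0 := det4_self₂₄ _ _ _
    have hNk : ⟪N, u k⟫ = 0 := det4_self₃ _ _ _
    let f : StrongDual ℝ E4 := innerSL ℝ (u i + u j + u k)
    have hf : ∀ x, f x = ⟪x, u i⟫ + ⟪x, u j⟫ + ⟪x, u k⟫ := fun x => by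
      simp only [f, innerSL_apply_apply]
      rw [real_inner_comm, inner_add_right, inner_add_right]
    let R : Set E4 := {x ∈ polyCone u | ∀ y ∈ polyCone u, f y ≤ f x}
    have hNR : N ∈ R := by
      refine ⟨h.1, fun y hy => ?_⟩
      rw [hf, hf, hNi, hNj, hNk]
      linarith [hy i, hy j, hy k]
    have hR : ∀ x ∈ R, ⟪x, u i⟫ = 0 ∧ ⟪x, u j⟫ = 0 ∧ ⟪x, u k⟫ = 0 := by
      intro x hx
      have h1 := hx.2 0 zero_mem
      rw [map_zero, hf] at h1
      have h2 := hx.1 i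
      have h3 := hx.1 j
      have h4 := hx.1 k
      refine ⟨?_, ?_, ?_⟩ <;> linarith
    have hspan : Submodule.span ℝ R = ℝ ∙ N := by
      refine le_antisymm (Submodule.span_le.2 fun x hx => ?_)
        (Submodule.span_mono (Set.singleton_subset_iff.2 hNR))
      obtain ⟨hi, hj, hk⟩ := hR x hx
      obtain ⟨t, rfl⟩ := eq_smul_cross3 h.2 hi hj hk
      exact Submodule.smul_mem _ _ (Submodule.mem_span_singleton_self _)
    have hcard := hsimple R (fun _ => ⟨f, rfl⟩) (by rw [hspan]; exact finrank_span_singleton h.2)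
    have hsub : ({i, j, k} : Set (Fin n)) ⊆ {i : Fin n | ∀ x ∈ R, ⟪x, u i⟫ = 0} := by
      rintro m (rfl | rfl | rfl) x hx
      exacts [(hR x hx).1, (hR x hx).2.1, (hR x hx).2.2]
    have heq := Set.eq_of_subset_of_ncard_le hsub
      (by rw [hcard, Set.ncard_eq_three.2 ⟨i, j, k, h.ne₁, h.ne₃.symm, h.ne₂, rfl⟩])
    have hmem : l ∈ {i : Fin n | ∀ x ∈ R, ⟪x, u i⟫ = 0} := by
      intro x hx
      obtain ⟨hi, hj, hk⟩ := hR x hx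
      obtain ⟨t, rfl⟩ := eq_smul_cross3 h.2 hi hj hk
      rw [real_inner_smul_left, hl, mul_zero]
    rw [← heq] at hmem
    exact hmem

lemma inner_neg_of_mem_interior_polyCone {e : E4} (he : e ∈ interior (polyCone u)) {i : Fin n}
    (hi : u i ≠ 0) : ⟪e, u i⟫ < 0 := by
  have hlim : Filter.Tendsto (fun t : ℝ => e + t • u i) (nhdsWithin 0 (Set.Ioi 0)) (nhds e) := by
    have : Continuous fun t : ℝ => e + t • u i := by fun_prop
    simpa using (this.tendsto 0).mono_left nhdsWithin_le_nhds
  obtain ⟨t, ht, ht0⟩ := ((hlim.eventually (mem_interior_iff_mem_nhds.1 he)).and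
    self_mem_nhdsWithin).exists
  have h1 := ht i
  rw [inner_add_left, real_inner_smul_left] at h1
  have h2 : 0 < t * ⟪u i, u i⟫ := mul_pos ht0 (real_inner_self_pos.2 hi)
  linarith

lemma IsSimpleCone.finrank_span_edge {p : E4} (hu : IsSimpleCone u p) {i j : Fin n}
    (h : IsEdge u i j) :
    Module.finrank ℝ (Submodule.span ℝ
      (polyCone u ∩ {x | ⟪x, u i⟫ = 0} ∩ {x | ⟪x, u j⟫ = 0})) = 2 := by
  have hf := h.flag
  have hf' := (hu.edge_symm h).flag
  set k := third u i j
  set k' := third u j i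
  have hk : k ≠ k' := by
    intro hk
    rw [← hk] at hf'
    exact hu.not_flag_swap hf.rotate.rotate hf'.rotate.rotate
  set N := cross3 (u i) (u j) (u k) with hN
  set N' := cross3 (u j) (u i) (u k') with hN'
  have hNk' : ⟪N, u k'⟫ < 0 := hu.inner_neg hf hf'.ne₂.symm hf'.ne₃ hk.symm
  have hspan : Submodule.span ℝ (polyCone u ∩ {x | ⟪x, u i⟫ = 0} ∩ {x | ⟪x, u j⟫ = 0}) =
      Submodule.span ℝ (Set.range ![N, N']) := by
    refine le_antisymm (Submodule.span_le.2 ?_) (Submodule.span_mono ?_)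
    · rintro x ⟨⟨hx, hxi⟩, hxj⟩
      have hN'k : ⟪N', u k⟫ < 0 := hu.inner_neg hf' hf.ne₂.symm hf.ne₃ hk
      set r := ⟪x, u k⟫ / ⟪N', u k⟫ with hr
      obtain ⟨t, ht⟩ := eq_smul_cross3 (x := x - r • N') hf.2
        (by rw [inner_sub_left, real_inner_smul_left, inner_cross3, det4_self₂₄, hxi]; ring)
        (by rw [inner_sub_left, real_inner_smul_left, inner_cross3, det4_self₁₄, hxj]; ring)
        (by rw [inner_sub_left, real_inner_smul_left, hr, div_mul_cancel₀ _ hN'k.ne, sub_self])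
      rw [sub_eq_iff_eq_add.1 ht]
      exact Submodule.add_mem _
        (Submodule.smul_mem _ _ (Submodule.subset_span ⟨0, rfl⟩))
        (Submodule.smul_mem _ _ (Submodule.subset_span ⟨1, rfl⟩))
    · rintro x ⟨m, rfl⟩
      fin_cases m
      · exact ⟨⟨hf.1, det4_self₁₄ _ _ _⟩, det4_self₂₄ _ _ _⟩
      · exact ⟨⟨hf'.1, det4_self₂₄ _ _ _⟩, det4_self₁₄ _ _ _⟩
  have hind : LinearIndependent ℝ ![N, N'] := by
    rw [LinearIndependent.pair_iff]
    intro a b hab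
    have h1 := congrArg (fun x => ⟪x, u k'⟫) hab
    have hN'k' : ⟪N', u k'⟫ = 0 := det4_self₃ _ _ _
    simp only [inner_add_left, real_inner_smul_left, hN'k', mul_zero, add_zero,
      inner_zero_left] at h1
    have ha := (mul_eq_zero.1 h1).resolve_right hNk'.ne
    rw [ha, zero_smul, zero_add] at hab
    exact ⟨ha, (smul_eq_zero.1 hab).resolve_right hf'.2⟩
  rw [hspan, finrank_span_eq_card hind, Fintype.card_fin]

end Polyhedron

/-- Infinitesimal Gauss rigidity of simple convex spherical polyhedra: let
`P = C ∩ S³` be a simple convex spherical polyhedron, `C = {x : ⟨x, uᵢ⟩ ≤ 0 ∀i}` with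
pairwise distinct unit outward facet normals `uᵢ`. If `w` is a tangential variation of
the normals (`⟨uᵢ, wᵢ⟩ = 0`) keeping all dihedral angles constant in the first order
(`⟨wᵢ, uⱼ⟩ + ⟨uᵢ, wⱼ⟩ = 0` for adjacent facets `i, j`), then `w` is induced by an
infinitesimal rotation, i.e. a skew-symmetric linear map of ℝ⁴. -/
theorem spherical_gauss_rigidity {n : ℕ}
    (u : Fin n → EuclideanSpace ℝ (Fin 4))
    (hunit : ∀ i, ‖u i‖ = 1) (hinj : Function.Injective u)
    (C : Set (EuclideanSpace ℝ (Fin 4)))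
    (hC : C = {x | ∀ i, ⟪x, u i⟫ ≤ 0})
    (hint : (interior C).Nonempty)
    (hpointed : C ∩ (-C) = {0})
    (hfacet : ∀ i,
      Module.finrank ℝ (Submodule.span ℝ (C ∩ {x | ⟪x, u i⟫ = 0})) = 3)
    (hsimple : ∀ R : Set (EuclideanSpace ℝ (Fin 4)), IsExposed ℝ C R →
      Module.finrank ℝ (Submodule.span ℝ R) = 1 →
      {i : Fin n | ∀ x ∈ R, ⟪x, u i⟫ = 0}.ncard = 3)
    (w : Fin n → EuclideanSpace ℝ (Fin 4))
    (htangent : ∀ i, ⟪u i, w i⟫ = 0)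
    (hadjacent : ∀ i j, i ≠ j →
      Module.finrank ℝ
        (Submodule.span ℝ (C ∩ {x | ⟪x, u i⟫ = 0} ∩ {x | ⟪x, u j⟫ = 0})) = 2 →
      ⟪w i, u j⟫ + ⟪u i, w j⟫ = 0) :
    ∃ A : EuclideanSpace ℝ (Fin 4) →ₗ[ℝ] EuclideanSpace ℝ (Fin 4),
      (∀ x y, ⟪A x, y⟫ = -⟪x, A y⟫) ∧ ∀ i, w i = A (u i) := by
  subst hC
  change (interior (polyCone u)).Nonempty at hint
  have hu0 : ∀ i, u i ≠ 0 := fun i h => by simpa [h] using hunit i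
  have hu : IsSimpleCone u (-∑ i, u i) := isSimpleCone_neg_sum hpointed hsimple
  obtain ⟨e, he⟩ := hint
  refine hu.exists_rotation (fun i => inner_neg_of_mem_interior_polyCone he (hu0 i)) (fun i => ?_)
    htangent fun i j h => hadjacent i j h.flag.ne₁ (hu.finrank_span_edge h)
  obtain ⟨x, ⟨hx, hxi⟩, hx0⟩ : ∃ x ∈ polyCone u ∩ {x | ⟪x, u i⟫ = 0}, x ≠ 0 := by
    by_contra! hzero
    have h3 := hfacet i
    have hbot : Submodule.span ℝ (polyCone u ∩ {x | ⟪x, u i⟫ = 0}) = ⊥ :=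
      Submodule.span_eq_bot.2 hzero
    change Module.finrank ℝ (Submodule.span ℝ (polyCone u ∩ {x | ⟪x, u i⟫ = 0})) = 3 at h3
    rw [hbot, finrank_bot] at h3
    exact absurd h3 (by norm_num)
  exact hu.exists_flag hx hx0 hxi (hu0 i)
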